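/- Let n ≥ 1 and let f : ℝⁿ → ℝ be twice continuously differentiable with gradient g and Hessian H, where H is Lipschitz continuous with constant L > 0 and f is bounded below by f_inf ∈ ℝ; set β := L/2. Let ε > 0 and δ := √ε/β. Consider the fixed-radius trust region iteration: x_{k+1} = x_k + s_k, where for each k, the pair (s_k, ξ_k) satisfies g(x_k) + (H(x_k) + ξ_k I)s_k = 0, H(x_k) + ξ_k I ⪰ 0, ξ_k ≥ 0, ‖s_k‖ ≤ δ, and ξ_k(δ − ‖s_k‖) = 0. If N ∈ ℕ is such that ξ_k > √ε for every k < N, then N ≤ 6β²(f(x₀) − f_inf)/ε^{3/2}. -/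

import Mathlib

open scoped RealInnerProductSpace

lemma le_of_hasDerivAt_nonpos {φ φ' : ℝ → ℝ} (hφ : ∀ t, HasDerivAt φ (φ' t) t)
    (hφ' : ∀ t, 0 ≤ t → φ' t ≤ 0) {t : ℝ} (ht : 0 ≤ t) : φ t ≤ φ 0 := by
  have hanti : AntitoneOn φ (Set.Ici 0) :=
    antitoneOn_of_hasDerivWithinAt_nonpos (f' := φ') (convex_Ici 0)
      (fun u _ => (hφ u).continuousAt.continuousWithinAt)
      (fun u _ => (hφ u).hasDerivWithinAt)
      (fun u hu => hφ' u (interior_subset hu))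
  exact hanti Set.self_mem_Ici ht ht

/-- Second-order Taylor upper bound for a function with Lipschitz continuous Hessian. -/
lemma le_quadratic_model_add_cube {E : Type*} [NormedAddCommGroup E] [InnerProductSpace ℝ E]
    [CompleteSpace E] {f : E → ℝ} {g : E → E} {H : E → E →L[ℝ] E}
    (hg : ∀ y, HasGradientAt f (g y) y) (hH : ∀ y, HasFDerivAt g (H y) y)
    {L : ℝ} (hLip : ∀ y z, ‖H y - H z‖ ≤ L * ‖y - z‖) (x s : E) :
    f (x + s) ≤ f x + ⟪g x, s⟫ + ⟪s, H x s⟫ / 2 + L / 6 * ‖s‖ ^ 3 := by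
  have hline (t : ℝ) : HasDerivAt (fun t : ℝ => x + t • s) s t := by
    simpa using ((hasDerivAt_id t).smul_const s).const_add x
  have hf1 (t : ℝ) : HasDerivAt (fun t : ℝ => f (x + t • s)) ⟪g (x + t • s), s⟫ t := by
    simpa [Function.comp_def] using (hg (x + t • s)).hasFDerivAt.comp_hasDerivAt t (hline t)
  have hg1 (t : ℝ) :
      HasDerivAt (fun t : ℝ => ⟪g (x + t • s), s⟫) ⟪H (x + t • s) s, s⟫ t := by
    simpa using ((hH (x + t • s)).comp_hasDerivAt t (hline t)).inner ℝ (hasDerivAt_const t s)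
  have hpow (c : ℝ) (m : ℕ) (t : ℝ) :
      HasDerivAt (fun t : ℝ => c * t ^ m) (c * (m * t ^ (m - 1))) t :=
    (hasDerivAt_pow m t).const_mul c
  have hslope (t : ℝ) (ht : 0 ≤ t) :
      ⟪g (x + t • s), s⟫ - ⟪g x, s⟫ - ⟪s, H x s⟫ * t ^ 1 - L / 2 * ‖s‖ ^ 3 * t ^ 2 ≤ 0 := by
    have h := le_of_hasDerivAt_nonpos
      (fun t => (((hg1 t).sub_const ⟪g x, s⟫).sub (hpow ⟪s, H x s⟫ 1 t)).sub
        (hpow (L / 2 * ‖s‖ ^ 3) 2 t)) (fun t ht => ?_) ht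
    · simpa using h
    · have hcurv : ⟪(H (x + t • s) - H x) s, s⟫ ≤ L * t * ‖s‖ ^ 3 := by
        calc ⟪(H (x + t • s) - H x) s, s⟫
            ≤ ‖(H (x + t • s) - H x) s‖ * ‖s‖ := real_inner_le_norm _ _
          _ ≤ L * ‖x + t • s - x‖ * ‖s‖ * ‖s‖ := by
              gcongr
              exact ((H (x + t • s) - H x).le_opNorm s).trans (by gcongr; exact hLip _ _)
          _ = L * t * ‖s‖ ^ 3 := by
              rw [add_sub_cancel_left, norm_smul, Real.norm_of_nonneg ht]; ring
      rw [sub_apply, inner_sub_left, real_inner_comm s (H x s)] at hcurv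
      norm_num
      linarith
  have h := le_of_hasDerivAt_nonpos
    (fun t => (((hf1 t).sub (hpow ⟪g x, s⟫ 1 t)).sub (hpow (⟪s, H x s⟫ / 2) 2 t)).sub
      (hpow (L / 6 * ‖s‖ ^ 3) 3 t)) (fun t ht => ?_) zero_le_one
  · norm_num at h
    linarith
  · have := hslope t ht
    norm_num at this ⊢
    linarith

/-- The model decrease produced by a stationary pair of the trust region subproblem. -/
lemma quadratic_model_le_of_stationary {E : Type*} [NormedAddCommGroup E]
    [InnerProductSpace ℝ E] {g s : E} {H : E →L[ℝ] E} {ξ : ℝ}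
    (hstat : g + H s + ξ • s = 0) (hpsd : 0 ≤ ⟪s, H s⟫ + ξ * ‖s‖ ^ 2) :
    ⟪g, s⟫ + ⟪s, H s⟫ / 2 ≤ -(ξ * ‖s‖ ^ 2) / 2 := by
  have h : ⟪g + H s + ξ • s, s⟫ = 0 := by rw [hstat, inner_zero_left]
  rw [inner_add_left, inner_add_left, real_inner_smul_left, real_inner_self_eq_norm_sq,
    real_inner_comm s (H s)] at h
  linarith

/-- Iteration-counting bound of Section 2.5: for the fixed-radius trust region
iteration, the number of consecutive initial iterations with multiplier
`ξ_k > √ε` is at most `6β²(f(x₀) − f_inf)/ε^{3/2}`, where `β = L/2`. -/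
theorem fixed_radius_iteration_count
    (n : ℕ) (hn : 1 ≤ n)
    (f : EuclideanSpace ℝ (Fin n) → ℝ)
    (g : EuclideanSpace ℝ (Fin n) → EuclideanSpace ℝ (Fin n))
    (H : EuclideanSpace ℝ (Fin n) → EuclideanSpace ℝ (Fin n) →L[ℝ] EuclideanSpace ℝ (Fin n))
    (hf : ContDiff ℝ 2 f)
    (hg : ∀ y, HasGradientAt f (g y) y)
    (hH : ∀ y, HasFDerivAt g (H y) y)
    (L : ℝ) (hL : 0 < L)
    (hLip : ∀ y z : EuclideanSpace ℝ (Fin n), ‖H y - H z‖ ≤ L * ‖y - z‖)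
    (finf : ℝ) (hfinf : ∀ y, finf ≤ f y)
    (β : ℝ) (hβ : β = L / 2)
    (ε : ℝ) (hε : 0 < ε)
    (δ : ℝ) (hδ : δ = Real.sqrt ε / β)
    (x s : ℕ → EuclideanSpace ℝ (Fin n)) (ξ : ℕ → ℝ)
    (hiter : ∀ k : ℕ, x (k+1) = x k + s k)
    (hstat : ∀ k : ℕ, g (x k) + H (x k) (s k) + ξ k • s k = 0)
    (hpsd : ∀ k : ℕ, ∀ v : EuclideanSpace ℝ (Fin n), 0 ≤ ⟪v, H (x k) v⟫ + ξ k * ‖v‖^2)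
    (hξ0 : ∀ k : ℕ, 0 ≤ ξ k)
    (hsk : ∀ k : ℕ, ‖s k‖ ≤ δ)
    (hcomp : ∀ k : ℕ, ξ k * (δ - ‖s k‖) = 0)
    (N : ℕ)
    (hN : ∀ k : ℕ, k < N → Real.sqrt ε < ξ k) :
    (N : ℝ) ≤ 6 * β^2 * (f (x 0) - finf) / (Real.sqrt ε)^3 := by
  have hβ0 : 0 < β := by rw [hβ]; positivity
  have hr : 0 < √ε := Real.sqrt_pos.2 hε
  have hdec (k : ℕ) (hk : k < N) : f (x (k + 1)) ≤ f (x k) - √ε ^ 3 / (6 * β ^ 2) := by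
    have hξ : √ε < ξ k := hN k hk
    have hnorm : ‖s k‖ = √ε / β := by
      have := (mul_eq_zero.1 (hcomp k)).resolve_left (hr.trans hξ).ne'
      linarith
    have htaylor := le_quadratic_model_add_cube hg hH hLip (x k) (s k)
    have hmodel := quadratic_model_le_of_stationary (hstat k) (hpsd k (s k))
    have hmul : √ε * ‖s k‖ ^ 2 ≤ ξ k * ‖s k‖ ^ 2 := by gcongr
    have hvalue : -(√ε * ‖s k‖ ^ 2) / 2 + L / 6 * ‖s k‖ ^ 3 = -(√ε ^ 3 / (6 * β ^ 2)) := by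
      rw [hnorm, show L = 2 * β by linarith]
      field_simp
      ring
    rw [hiter k]
    linarith
  have hsum (m : ℕ) (hm : m ≤ N) : f (x m) ≤ f (x 0) - m * (√ε ^ 3 / (6 * β ^ 2)) := by
    induction m with
    | zero => simp
    | succ m ih =>
      have := ih (by lia)
      have := hdec m hm
      push_cast
      linarith
  have htotal : N * (√ε ^ 3 / (6 * β ^ 2)) ≤ f (x 0) - finf := by
    linarith [hsum N le_rfl, hfinf (x N)]
  rw [← mul_div_assoc, div_le_iff₀ (by positivity)] at htotal
  rw [le_div_iff₀ (by positivity)]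
  linarith
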